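/- Let d ∈ {1,…,p} and let M be an A-module lying in EIP_d with a_1(M) = 1, where a_1(M) := dim_k M − 2·dim_k 𝔪M + dim_k 𝔪²M. Set n := dim_k M/𝔪M and assume n ≥ d. Then there exists a surjective A-linear map W_{n,d} → M. -/

import Mathlib

open MvPolynomial Module

set_option maxHeartbeats 1000000
set_option synthInstance.maxHeartbeats 400000

noncomputable section

/-- The defining ideal `(X^p, Y^p)` of the polynomial ring in two variables. -/
def relI (k : Type) [Field k] (p : ℕ) : Ideal (MvPolynomial (Fin 2) k) :=
  Ideal.span {(X 0 : MvPolynomial (Fin 2) k) ^ p, (X 1 : MvPolynomial (Fin 2) k) ^ p}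

/-- The algebra `A = k[X,Y]/(X^p, Y^p)`. -/
abbrev Amod (k : Type) [Field k] (p : ℕ) : Type :=
  MvPolynomial (Fin 2) k ⧸ relI k p

variable (k : Type) [Field k] (p : ℕ)

/-- `x`, the image of `X` in `A`. -/
def xA : Amod k p := Ideal.Quotient.mk (relI k p) (X 0)

/-- `y`, the image of `Y` in `A`. -/
def yA : Amod k p := Ideal.Quotient.mk (relI k p) (X 1)

/-- The maximal ideal `𝔪 = (x, y)` of `A`. -/
def mA : Ideal (Amod k p) := Ideal.span {xA k p, yA k p}

/-- A point operator: `u = α x + β y` with `(α, β) ≠ (0, 0)`. -/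
def IsPointOp (u : Amod k p) : Prop :=
  ∃ α β : k, (α ≠ 0 ∨ β ≠ 0) ∧ u = α • xA k p + β • yA k p

/-- Equal images property: `u M = 𝔪 M` for every point operator `u`. -/
def EIP (M : Type) [AddCommGroup M] [Module (Amod k p) M] : Prop :=
  ∀ u : Amod k p, IsPointOp k p u →
    LinearMap.range (LinearMap.lsmul (Amod k p) M u)
      = mA k p • (⊤ : Submodule (Amod k p) M)

/-- `M` lies in `EIP_d`: equal images property and `𝔪^d M = 0`. -/
def EIPd (d : ℕ) (M : Type) [AddCommGroup M] [Module (Amod k p) M] : Prop :=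
  EIP k p M ∧ (mA k p) ^ d • (⊤ : Submodule (Amod k p) M) = ⊥


/-- The standard basis vector `v_i` of the free module `A^n`. -/
def stdV (n : ℕ) (i : Fin n) : Fin n → Amod k p := Pi.single i 1

/-- The set of defining relations of the module `W_{n,d}` inside the free module `A^n`
(indices of `v_1, …, v_n` are `0, …, n-1`): `x·v_1`, `y·v_n`, `x^d·v_i` for `2 ≤ i ≤ n`,
and `y·v_i − x·v_{i+1}` for `1 ≤ i ≤ n−1`. -/
def NSet (n d : ℕ) : Set (Fin n → Amod k p) :=
  (⋃ (i : Fin n) (_ : i.val = 0), {xA k p • stdV k p n i}) ∪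
  (⋃ (i : Fin n) (_ : i.val = n - 1), {yA k p • stdV k p n i}) ∪
  (⋃ (i : Fin n) (_ : i.val ≠ 0), {(xA k p) ^ d • stdV k p n i}) ∪
  (⋃ (i : Fin n) (j : Fin n) (_ : j.val = i.val + 1),
    {yA k p • stdV k p n i - xA k p • stdV k p n j})

/-- The submodule `N_{n,d} ⊆ A^n` of defining relations of `W_{n,d}`. -/
def NSub (n d : ℕ) : Submodule (Amod k p) (Fin n → Amod k p) :=
  Submodule.span (Amod k p) (NSet k p n d)

/-- The module `W_{n,d} = A^n / N_{n,d}`. -/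
abbrev Wmod (n d : ℕ) : Type := (Fin n → Amod k p) ⧸ NSub k p n d

section CoreLinearAlgebra

/-- The linear map `K[X] → D` sending `X^i` to `w i`. -/
def seqMap {K D : Type} [Field K] [AddCommGroup D] [Module K D] (w : ℕ → D) :
    Polynomial K →ₗ[K] D := (Polynomial.basisMonomials K).constr K w

theorem seqMap_monomial {K D : Type} [Field K] [AddCommGroup D] [Module K D] (w : ℕ → D)
    (i : ℕ) (a : K) : seqMap w (Polynomial.monomial i a) = a • w i := by
  have h : Polynomial.monomial i a = a • Polynomial.basisMonomials K i := by
    simp [Polynomial.coe_basisMonomials, Polynomial.smul_monomial]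
  rw [h, map_smul, seqMap, Basis.constr_basis]

theorem seqMap_mul {K D : Type} [Field K] [AddCommGroup D] [Module K D] (w : ℕ → D) (r : K)
    (g : Polynomial K) :
    seqMap w ((Polynomial.X - Polynomial.C r) * g) = seqMap (fun i => w (i + 1) - r • w i) g := by
  induction g using Polynomial.induction_on' with
  | add p q hp hq => rw [mul_add, map_add, map_add, hp, hq]
  | monomial i a =>
    rw [sub_mul, map_sub, Polynomial.X_mul_monomial, Polynomial.C_mul_monomial]
    simp only [seqMap_monomial]
    rw [smul_sub, smul_smul, mul_comm r a]

variable {K M : Type} [Field K] [AddCommGroup M] [Module K M]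

theorem seq_vanish [IsAlgClosed K] (x y : M →ₗ[K] M) (Q P : Submodule K M)
    (hQP : ∀ α β : K, (α ≠ 0 ∨ β ≠ 0) → Q.map (α • x + β • y) = P) (n : ℕ) :
    ∀ (w : ℕ → Dual K M) (f : Polynomial K),
      (∀ i < n, ∀ v ∈ Q, w (i + 1) (y v) = w i (x v)) → f ≠ 0 → f.natDegree ≤ n →
      (∀ v ∈ P, seqMap w f v = 0) → ∀ i ≤ n, ∀ v ∈ P, w i v = 0 := by
  have hx : Q.map x = P := by simpa using hQP 1 0 (by simp)
  have hy : Q.map y = P := by simpa using hQP 0 1 (by simp)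
  induction n with
  | zero =>
    intro w f _ hf hdeg hv i hi v hvP
    obtain rfl : i = 0 := by omega
    have h1 := Polynomial.eq_C_of_natDegree_le_zero hdeg
    have h2 := hv v hvP
    rw [h1, ← Polynomial.monomial_zero_left, seqMap_monomial] at h2
    have h3 : f.coeff 0 ≠ 0 := by
      intro h
      rw [h] at h1
      exact hf (by simpa using h1)
    simpa [h3] using h2
  | succ n ih =>
    intro w f hw hf hdeg hv
    by_cases hd : f.natDegree ≤ n
    · have h0 := ih w f (fun i hi => hw i (by omega)) hf hd hv
      intro i hi v hvP
      rcases Nat.lt_or_ge n i with h | h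
      · obtain rfl : i = n + 1 := by omega
        rw [← hy] at hvP
        obtain ⟨m, hm, rfl⟩ := hvP
        rw [hw n (by omega) m hm]
        exact h0 n le_rfl _ (hx ▸ Submodule.mem_map_of_mem hm)
      · exact h0 i h v hvP
    · have hdeg' : f.degree ≠ 0 := by
        intro h
        have h2 : f.natDegree = 0 := Polynomial.natDegree_eq_zero_iff_degree_le_zero.mpr h.le
        omega
      obtain ⟨r, hr⟩ := IsAlgClosed.exists_root f hdeg'
      obtain ⟨g, rfl⟩ := Polynomial.dvd_iff_isRoot.mpr hr
      have hg : g ≠ 0 := right_ne_zero_of_mul hf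
      have hgd : g.natDegree ≤ n := by
        rw [Polynomial.natDegree_mul (Polynomial.X_sub_C_ne_zero r) hg,
          Polynomial.natDegree_X_sub_C] at hdeg
        omega
      rw [seqMap_mul] at hv
      have h0 := ih (fun i => w (i + 1) - r • w i) g (by
        intro i hi v hvQ
        simp [hw i (by omega) v hvQ, hw (i + 1) (by omega) v hvQ]) hg hgd hv
      have h1 : ∀ i ≤ n, ∀ v ∈ P, w i v = 0 := by
        intro i hi v hvP
        rw [← hQP 1 (-r) (by simp)] at hvP
        obtain ⟨m, hm, rfl⟩ := hvP
        have h2 := h0 i hi (y m) (hy ▸ Submodule.mem_map_of_mem hm)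
        simp only [LinearMap.sub_apply, LinearMap.smul_apply, hw i (by omega) m hm] at h2
        rw [LinearMap.add_apply, LinearMap.smul_apply, LinearMap.smul_apply, map_add, map_smul,
          map_smul, one_smul, neg_smul, ← sub_eq_add_neg]
        exact h2
      intro i hi v hvP
      rcases Nat.lt_or_ge n i with h | h
      · obtain rfl : i = n + 1 := by omega
        have h2 := h0 n le_rfl v hvP
        simpa [h1 n le_rfl v hvP] using h2
      · exact h1 i h v hvP

theorem finrank_map_add_inf_ker {N : Type} [AddCommGroup N] [Module K N] [FiniteDimensional K M]
    (f : M →ₗ[K] N) (S : Submodule K M) :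
    finrank K (S.map f) + finrank K ↥(S ⊓ LinearMap.ker f) = finrank K S := by
  have h := LinearMap.finrank_range_add_finrank_ker (f.domRestrict S)
  rw [LinearMap.range_domRestrict] at h
  rw [← h, LinearMap.ker_domRestrict]
  congr 1
  rw [← Submodule.map_comap_subtype]
  exact Submodule.finrank_map_subtype_eq S (Submodule.comap S.subtype (LinearMap.ker f))

/-- nonzero polynomial whose associated combination of functionals vanishes on `P`. -/
theorem exists_poly [FiniteDimensional K M] (P P' : Submodule K M) (hP : P' ≤ P) (n : ℕ)
    (hn : finrank K P ≤ finrank K P' + n) (w : ℕ → Dual K M)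
    (hw : ∀ i ≤ n, ∀ v ∈ P', w i v = 0) :
    ∃ f : Polynomial K, f ≠ 0 ∧ f.natDegree ≤ n ∧ ∀ v ∈ P, seqMap w f v = 0 := by
  obtain ⟨C, hdis, hsup⟩ := IsModularLattice.exists_disjoint_and_sup_eq hP
  have hC : finrank K C ≤ n := by
    have h := Submodule.finrank_sup_add_finrank_inf_eq P' C
    rw [hsup, hdis.eq_bot, finrank_bot] at h
    omega
  let T : (Fin (n + 1) → K) →ₗ[K] Dual K C :=
    C.subtype.dualMap ∘ₗ seqMap w ∘ₗ (Polynomial.degreeLT K (n + 1)).subtype ∘ₗ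
      (Polynomial.degreeLTEquiv K (n + 1)).symm.toLinearMap
  have hker : LinearMap.ker T ≠ ⊥ := by
    apply LinearMap.ker_ne_bot_of_finrank_lt
    rw [Subspace.dual_finrank_eq, Module.finrank_fin_fun]
    omega
  obtain ⟨c, hc, hc0⟩ := (Submodule.ne_bot_iff _).mp hker
  set f := (Polynomial.degreeLTEquiv K (n + 1)).symm c with hf
  have hfd : (f : Polynomial K).degree < ((n + 1 : ℕ) : WithBot ℕ) := Polynomial.mem_degreeLT.mp f.2
  have hf0 : (f : Polynomial K) ≠ 0 := by
    intro h
    apply hc0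
    have : f = 0 := Subtype.ext h
    simpa [hf] using this
  have hnd : (f : Polynomial K).natDegree ≤ n := by
    have := (Polynomial.natDegree_lt_iff_degree_lt hf0).mpr hfd
    omega
  refine ⟨f, hf0, hnd, ?_⟩
  intro v hv
  rw [← hsup] at hv
  obtain ⟨a, ha, b, hb, rfl⟩ := Submodule.mem_sup.mp hv
  rw [map_add]
  have h1 : seqMap w (f : Polynomial K) b = 0 := by
    have := LinearMap.congr_fun (LinearMap.mem_ker.mp hc) ⟨b, hb⟩
    exact this
  have h2 : seqMap w (f : Polynomial K) a = 0 := by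
    rw [Polynomial.as_sum_range' (f : Polynomial K) (n + 1) (by omega), map_sum,
      LinearMap.sum_apply]
    apply Finset.sum_eq_zero
    intro i hi
    rw [seqMap_monomial, LinearMap.smul_apply, hw i (by simpa [Nat.lt_succ_iff] using hi) a ha,
      smul_zero]
  rw [h1, h2, add_zero]

/-- The map `(v_i) ↦ (x v_1, x v_2 - y v_1, …, x v_n - y v_{n-1}, - y v_n)`. -/
def pencilMap (x y : M →ₗ[K] M) (n : ℕ) : (Fin n → M) →ₗ[K] (Fin (n + 1) → M) :=
  ∑ i : Fin n, (LinearMap.single K (fun _ => M) i.castSucc ∘ₗ x ∘ₗ LinearMap.proj i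
    - LinearMap.single K (fun _ => M) i.succ ∘ₗ y ∘ₗ LinearMap.proj i)

theorem pencilMap_eq (x y : M →ₗ[K] M) (n : ℕ) (v : Fin n → M) :
    pencilMap x y n v = ∑ i : Fin n,
      (Pi.single i.castSucc (x (v i)) - Pi.single i.succ (y (v i)) : Fin (n + 1) → M) := by
  simp [pencilMap, LinearMap.sum_apply]

theorem pencilMap_apply (x y : M →ₗ[K] M) (n : ℕ) (v : Fin n → M) (j : Fin (n + 1)) :
    pencilMap x y n v j = (∑ i : Fin n, if j = i.castSucc then x (v i) else 0)
      - ∑ i : Fin n, if j = i.succ then y (v i) else 0 := by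
  rw [pencilMap_eq, Finset.sum_apply, ← Finset.sum_sub_distrib]
  simp [Pi.single_apply]

theorem pencilMap_single (x y : M →ₗ[K] M) (n : ℕ) (i : Fin n) (m : M) :
    pencilMap x y n (Pi.single i m) =
      (Pi.single i.castSucc (x m) - Pi.single i.succ (y m) : Fin (n + 1) → M) := by
  rw [pencilMap_eq, Finset.sum_eq_single i]
  · simp
  · intro b _ hb
    simp [hb]
  · simp

/-- tuples with entries in `S` -/
def tup (S : Submodule K M) (n : ℕ) : Submodule K (Fin n → M) :=
  LinearMap.range (S.subtype.compLeft (Fin n))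

theorem mem_tup (S : Submodule K M) (n : ℕ) (v : Fin n → M) : v ∈ tup S n ↔ ∀ i, v i ∈ S := by
  constructor
  · rintro ⟨u, rfl⟩ i
    exact (u i).2
  · intro h
    exact ⟨fun i => ⟨v i, h i⟩, rfl⟩

theorem finrank_tup [FiniteDimensional K M] (S : Submodule K M) (n : ℕ) :
    finrank K (tup S n) = n * finrank K S := by
  rw [tup, LinearMap.finrank_range_of_inj, Module.finrank_pi_fintype]
  · simp
  · intro a b h
    funext i
    exact Subtype.ext (congrFun h i)

theorem drop_le [FiniteDimensional K M] (x : M →ₗ[K] M) (F : ℕ → Submodule K M)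
    (hF : ∀ j, (F j).map x = F (j + 1)) (anti : ∀ j, F (j + 1) ≤ F j) (n : ℕ)
    (h1 : finrank K (F 1) ≤ finrank K (F 2) + n) (j : ℕ) :
    finrank K (F (j + 1)) ≤ finrank K (F (j + 2)) + n := by
  induction j with
  | zero => exact h1
  | succ j ih =>
    have a := finrank_map_add_inf_ker x (F (j + 1))
    have b := finrank_map_add_inf_ker x (F (j + 2))
    rw [hF] at a b
    have c : finrank K ↥(F (j + 2) ⊓ LinearMap.ker x) ≤ finrank K ↥(F (j + 1) ⊓ LinearMap.ker x) :=
      Submodule.finrank_mono (inf_le_inf_right _ (anti (j + 1)))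
    have e1 : j + 1 + 1 = j + 2 := rfl
    have e2 : j + 2 + 1 = j + 1 + 2 := rfl
    rw [e1] at a ⊢
    rw [e2] at b
    omega

theorem pencil_surj [IsAlgClosed K] [FiniteDimensional K M] (x y : M →ₗ[K] M)
    (F : ℕ → Submodule K M)
    (hF : ∀ j, ∀ α β : K, (α ≠ 0 ∨ β ≠ 0) → (F j).map (α • x + β • y) = F (j + 1))
    (anti : ∀ j, F (j + 1) ≤ F j) (d : ℕ) (hd : F d = ⊥) (n : ℕ)
    (h1 : finrank K (F 1) ≤ finrank K (F 2) + n) :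
    tup (F 2) (n + 1) ≤ (tup (F 1) n).map (pencilMap x y n) := by
  have hFx : ∀ j, (F j).map x = F (j + 1) := fun j => by simpa using hF j 1 0 (by simp)
  have hanti : Antitone F := antitone_nat_of_succ_le anti
  by_contra hcon
  obtain ⟨e, he, hne⟩ := Set.not_subset.mp hcon
  obtain ⟨φ, hφe, hφ⟩ := Submodule.exists_dual_map_eq_bot_of_notMem hne inferInstance
  have hφ' : ∀ u ∈ tup (F 1) n, φ (pencilMap x y n u) = 0 := by
    intro u hu
    have : φ (pencilMap x y n u) ∈ ((tup (F 1) n).map (pencilMap x y n)).map φ :=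
      Submodule.mem_map_of_mem (Submodule.mem_map_of_mem hu)
    rw [hφ] at this
    exact (Submodule.mem_bot K).mp this
  let w : ℕ → Dual K M := fun i =>
    if h : i < n + 1 then φ ∘ₗ LinearMap.single K (fun _ => M) (⟨i, h⟩ : Fin (n + 1)) else 0
  have hw : ∀ i < n, ∀ v ∈ F 1, w (i + 1) (y v) = w i (x v) := by
    intro i hi v hv
    have h := hφ' (Pi.single ⟨i, hi⟩ v) (by
      rw [mem_tup]
      intro j
      by_cases hj : j = ⟨i, hi⟩
      · subst hj; simpa using hv
      · simp [hj])
    rw [pencilMap_single, map_sub, sub_eq_zero] at h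
    have a1 : i + 1 < n + 1 := by omega
    have a2 : i < n + 1 := by omega
    simp only [w, dif_pos a1, dif_pos a2]
    exact h.symm
  have key : ∀ j, j ≤ d → ∀ i ≤ n, ∀ v ∈ F (d - j + 2), w i v = 0 := by
    intro j
    induction j with
    | zero =>
      intro _ i _ v hv
      have h2 : v ∈ F d := hanti (by omega) hv
      rw [hd] at h2
      rw [(Submodule.mem_bot K).mp h2, map_zero]
    | succ j ih =>
      intro hj
      have e : d - j = d - (j + 1) + 1 := by omega
      have ih' := ih (by omega)
      rw [e] at ih'
      generalize d - (j + 1) = t at ih' ⊢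
      obtain ⟨f, hf0, hfd, hfv⟩ := exists_poly (F (t + 2)) (F (t + 1 + 2)) (anti (t + 2)) n
        (drop_le x F hFx anti n h1 (t + 1)) w ih'
      exact seq_vanish x y (F (t + 1)) (F (t + 2)) (hF (t + 1)) n w f
        (fun i hi v hv => hw i hi v (hanti (by omega) hv)) hf0 hfd hfv
  have key2 : ∀ i ≤ n, ∀ v ∈ F 2, w i v = 0 := by
    have := key d le_rfl
    simpa using this
  apply hφe
  rw [← Finset.univ_sum_single e, map_sum]
  apply Finset.sum_eq_zero
  intro i _
  have h := key2 i.val (by omega) (e i) ((mem_tup _ _ _).mp he i)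
  simp only [w, dif_pos i.isLt] at h
  exact h

theorem exists_kernel [IsAlgClosed K] [FiniteDimensional K M] (x y : M →ₗ[K] M)
    (F : ℕ → Submodule K M) (hF0 : F 0 = ⊤)
    (hF : ∀ j, ∀ α β : K, (α ≠ 0 ∨ β ≠ 0) → (F j).map (α • x + β • y) = F (j + 1))
    (anti : ∀ j, F (j + 1) ≤ F j) (d : ℕ) (hd : F d = ⊥) (n : ℕ)
    (h0 : finrank K M = finrank K (F 1) + n)
    (h1 : finrank K (F 1) + 1 = finrank K (F 2) + n) :
    ∃ v : Fin n → M, pencilMap x y n v = 0 ∧ ∃ i, v i ∉ F 1 := by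
  have hsurj := pencil_surj x y F hF anti d hd n (by omega)
  have hFx : ∀ j, (F j).map x = F (j + 1) := fun j => by simpa using hF j 1 0 (by simp)
  have hFy : ∀ j, (F j).map y = F (j + 1) := fun j => by simpa using hF j 0 1 (by simp)
  have hx1 : ∀ m, x m ∈ F 1 := fun m => hFx 0 ▸ Submodule.mem_map_of_mem (hF0 ▸ Submodule.mem_top)
  have hy1 : ∀ m, y m ∈ F 1 := fun m => hFy 0 ▸ Submodule.mem_map_of_mem (hF0 ▸ Submodule.mem_top)
  by_contra hcon
  push Not at hcon
  have hker : LinearMap.ker (pencilMap x y n) ≤ tup (F 1) n := by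
    intro v hv
    rw [mem_tup]
    exact hcon v hv
  have hrange : LinearMap.range (pencilMap x y n) ≤ tup (F 1) (n + 1) := by
    rintro _ ⟨v, rfl⟩
    rw [mem_tup]
    intro j
    rw [pencilMap_apply]
    refine Submodule.sub_mem _ (Submodule.sum_mem _ fun i _ => ?_) (Submodule.sum_mem _ fun i _ => ?_)
    · split_ifs
      · exact hx1 _
      · exact Submodule.zero_mem _
    · split_ifs
      · exact hy1 _
      · exact Submodule.zero_mem _
  have a := LinearMap.finrank_range_add_finrank_ker (pencilMap x y n)
  have b := finrank_map_add_inf_ker (pencilMap x y n) (tup (F 1) n)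
  rw [inf_eq_right.mpr hker, finrank_tup] at b
  have c := Submodule.finrank_mono hrange
  have e := Submodule.finrank_mono hsurj
  rw [finrank_tup] at c e
  rw [Module.finrank_pi_fintype] at a
  simp only [Finset.sum_const, Finset.card_univ, Fintype.card_fin, smul_eq_mul] at a
  rw [h0] at a
  nlinarith

theorem pencil_rel (x y : M →ₗ[K] M) (n : ℕ) (v : Fin n → M) (hv : pencilMap x y n v = 0) :
    (∀ i : Fin n, i.val = 0 → x (v i) = 0) ∧ (∀ i : Fin n, i.val = n - 1 → y (v i) = 0) ∧
    (∀ i j : Fin n, j.val = i.val + 1 → y (v i) = x (v j)) := by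
  have s1 : ∀ j : Fin n, (∑ i : Fin n, if j.castSucc = i.castSucc then x (v i) else 0) = x (v j) := by
    intro j
    simp
  have s2 : ∀ j : Fin n, (∑ i : Fin n, if j.succ = i.succ then y (v i) else 0) = y (v j) := by
    intro j
    simp
  refine ⟨?_, ?_, ?_⟩
  · intro j hj
    have h := congrFun hv j.castSucc
    rw [pencilMap_apply, s1, Finset.sum_eq_zero] at h
    · simpa using h
    · intro i _
      rw [if_neg]
      intro h
      have := congrArg Fin.val h
      simp at this
      omega
  · intro j hj
    have h := congrFun hv j.succ
    rw [pencilMap_apply, s2, Finset.sum_eq_zero] at h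
    · simpa using h
    · intro i _
      rw [if_neg]
      intro h
      have := congrArg Fin.val h
      simp at this
      omega
  · intro i j hij
    have h := congrFun hv j.castSucc
    rw [pencilMap_apply, s1] at h
    have e : j.castSucc = i.succ := Fin.ext (by simpa using hij)
    rw [e, s2] at h
    exact (sub_eq_zero.mp h).symm

theorem core [IsAlgClosed K] [FiniteDimensional K M] (x y : M →ₗ[K] M)
    (F : ℕ → Submodule K M) (hF0 : F 0 = ⊤)
    (hF : ∀ j, ∀ α β : K, (α ≠ 0 ∨ β ≠ 0) → (F j).map (α • x + β • y) = F (j + 1))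
    (anti : ∀ j, F (j + 1) ≤ F j) (d : ℕ) (hd : F d = ⊥) (n : ℕ)
    (h0 : finrank K M = finrank K (F 1) + n)
    (h1 : finrank K (F 1) + 1 = finrank K (F 2) + n) :
    ∃ v : Fin n → M, (∀ i : Fin n, i.val = 0 → x (v i) = 0) ∧
      (∀ i : Fin n, i.val = n - 1 → y (v i) = 0) ∧
      (∀ i j : Fin n, j.val = i.val + 1 → y (v i) = x (v j)) ∧
      Submodule.span K (Set.range v) ⊔ F 1 = ⊤ := by
  obtain ⟨v, hv, hex⟩ := exists_kernel x y F hF0 hF anti d hd n h0 h1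
  obtain ⟨r1, r2, r3⟩ := pencil_rel x y n v hv
  refine ⟨v, r1, r2, r3, ?_⟩
  have hFx : ∀ j, (F j).map x = F (j + 1) := fun j => by simpa using hF j 1 0 (by simp)
  have hFy : ∀ j, (F j).map y = F (j + 1) := fun j => by simpa using hF j 0 1 (by simp)
  set V := Submodule.span K (Set.range v) ⊔ F 1 with hV
  have hvV : ∀ i, v i ∈ V := fun i =>
    (le_sup_left : _ ≤ V) (Submodule.subset_span (Set.mem_range_self i))
  have hFV : F 1 ≤ V := le_sup_right
  have hyV : V.map y ≤ V.map x := by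
    rw [Submodule.map_le_iff_le_comap, hV]
    refine sup_le (Submodule.span_le.mpr ?_) ?_
    · rintro _ ⟨i, rfl⟩
      change y (v i) ∈ V.map x
      by_cases h : i.val = n - 1
      · rw [r2 i h]
        exact Submodule.zero_mem _
      · have hi : i.val + 1 < n := by omega
        rw [r3 i ⟨i.val + 1, hi⟩ rfl]
        exact Submodule.mem_map_of_mem (hvV _)
    · rw [← Submodule.map_le_iff_le_comap, hFy, ← hFx]
      exact Submodule.map_mono hFV
  -- the kernel of `x` is contained in `V`
  have hrk : ∀ u : M →ₗ[K] M, (F 0).map u = F 1 → finrank K (LinearMap.ker u) = n := by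
    intro u hu
    have := LinearMap.finrank_range_add_finrank_ker u
    rw [hF0, Submodule.map_top] at hu
    rw [hu] at this
    omega
  have hkx := hrk x (hFx 0)
  have hk1 : finrank K ↥(F 1 ⊓ LinearMap.ker x) + 1 = n := by
    have := finrank_map_add_inf_ker x (F 1)
    rw [hFx] at this
    simp only [Nat.reduceAdd] at this
    omega
  have hz : ∃ z ∈ V, z ∈ LinearMap.ker x ∧ z ∉ F 1 := by
    have hexn : ∃ t : ℕ, ∃ h : t < n, v ⟨t, h⟩ ∉ F 1 := by
      obtain ⟨i, hi⟩ := hex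
      exact ⟨i.val, i.isLt, hi⟩
    classical
    obtain ⟨ht, hvt⟩ := Nat.find_spec hexn
    have hmin := fun m => Nat.find_min hexn (m := m)
    generalize Nat.find hexn = t at ht hvt hmin
    have hx2 : x (v ⟨t, ht⟩) ∈ F 2 := by
      rcases Nat.eq_zero_or_pos t with h | h
      · rw [r1 ⟨t, ht⟩ h]
        exact Submodule.zero_mem _
      · have hlt : t - 1 < n := by omega
        rw [← r3 ⟨t - 1, hlt⟩ ⟨t, ht⟩ (by simp; omega)]
        have h3 : v ⟨t - 1, hlt⟩ ∈ F 1 := by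
          by_contra h4
          exact hmin (t - 1) (by omega) ⟨hlt, h4⟩
        have := hFy 1
        rw [← this]
        exact Submodule.mem_map_of_mem h3
    rw [← hFx 1] at hx2
    obtain ⟨m, hm, hmx⟩ := hx2
    refine ⟨v ⟨t, ht⟩ - m, Submodule.sub_mem _ (hvV _) (hFV hm), ?_, ?_⟩
    · rw [LinearMap.mem_ker, map_sub, hmx, sub_self]
    · intro h
      exact hvt (by simpa using Submodule.add_mem _ h hm)
  have hkV : LinearMap.ker x ≤ V := by
    obtain ⟨z, hzV, hzx, hz1⟩ := hz
    have hlt : F 1 ⊓ LinearMap.ker x < V ⊓ LinearMap.ker x := by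
      refine lt_of_le_of_ne (inf_le_inf_right _ hFV) ?_
      intro h
      have : z ∈ V ⊓ LinearMap.ker x := ⟨hzV, hzx⟩
      rw [← h] at this
      exact hz1 this.1
    have := Submodule.finrank_lt_finrank_of_lt hlt
    have heq : V ⊓ LinearMap.ker x = LinearMap.ker x :=
      Submodule.eq_of_le_of_finrank_le inf_le_right (by omega)
    exact inf_eq_right.mp heq
  have hVrk : finrank K (V.map x) + n = finrank K V := by
    have := finrank_map_add_inf_ker x V
    rw [inf_eq_right.mpr hkV, hkx] at this
    exact this
  -- an eigenvalue argument on `M ⧸ V`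
  by_contra hne
  have hrx : LinearMap.range x = F 1 := by
    have := hFx 0
    rwa [hF0, Submodule.map_top] at this
  have hry : ∀ m, y m ∈ LinearMap.range x := by
    intro m
    have := hFy 0
    rw [hF0, Submodule.map_top] at this
    rw [hrx]
    exact this ▸ LinearMap.mem_range_self y m
  obtain ⟨g, hg⟩ := x.rangeRestrict.exists_rightInverse_of_surjective x.range_rangeRestrict
  let N0 : M →ₗ[K] M := g ∘ₗ y.codRestrict (LinearMap.range x) hry
  have hN0 : ∀ m, x (N0 m) = y m := by
    intro m
    have := LinearMap.congr_fun hg (y.codRestrict (LinearMap.range x) hry m)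
    exact congrArg Subtype.val this
  have hNV : V ≤ V.comap N0 := by
    intro m hm
    have h2 : y m ∈ V.map x := hyV (Submodule.mem_map_of_mem hm)
    obtain ⟨m', hm', hmm⟩ := h2
    have h3 : N0 m - m' ∈ V := hkV (by rw [LinearMap.mem_ker, map_sub, hN0, hmm, sub_self])
    have := Submodule.add_mem _ h3 hm'
    simpa using this
  have hnt : Nontrivial (M ⧸ V) := Submodule.Quotient.nontrivial_iff.mpr hne
  obtain ⟨μ, hμ⟩ := Module.End.exists_eigenvalue (V.mapQ V N0 hNV : Module.End K (M ⧸ V))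
  obtain ⟨q, hq⟩ := hμ.exists_hasEigenvector
  obtain ⟨m, rfl⟩ := Submodule.mkQ_surjective V q
  have hmV : m ∉ V := by
    intro h
    exact hq.2 (by simpa using h)
  have hmq := hq.apply_eq_smul
  simp only [Submodule.mkQ_apply, Submodule.mapQ_apply] at hmq
  rw [← Submodule.Quotient.mk_smul, Submodule.Quotient.eq] at hmq
  let u : M →ₗ[K] M := (-μ) • x + (1 : K) • y
  have hu : u m ∈ V.map x := by
    refine ⟨_, hmq, ?_⟩
    simp [u, hN0]
    abel
  have hku := hrk u (hF 0 (-μ) 1 (by simp))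
  have hVS : V ≤ (V.map x).comap u := by
    intro z hz
    change u z ∈ V.map x
    simp only [u, LinearMap.add_apply, LinearMap.smul_apply, one_smul]
    exact Submodule.add_mem _ (Submodule.smul_mem _ _ (Submodule.mem_map_of_mem hz))
      (hyV (Submodule.mem_map_of_mem hz))
  have hS := finrank_map_add_inf_ker u ((V.map x).comap u)
  have hS1 := Submodule.finrank_mono (Submodule.map_comap_le u (V.map x))
  have hS2 : finrank K ↥((V.map x).comap u ⊓ LinearMap.ker u) ≤ finrank K (LinearMap.ker u) :=
    Submodule.finrank_mono inf_le_right
  have heq := Submodule.eq_of_le_of_finrank_le hVS (by omega)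
  exact hmV (heq ▸ hu)

end CoreLinearAlgebra

theorem general_core {k : Type} [Field k] [IsAlgClosed k] {R : Type} [CommRing R] [Algebra k R]
    (I : Ideal R) (a b : R) (d : ℕ) (M : Type) [AddCommGroup M] [Module R M]
    [Module k M] [IsScalarTower k R M] [FiniteDimensional k M]
    (hEIP : ∀ α β : k, (α ≠ 0 ∨ β ≠ 0) →
      LinearMap.range (LinearMap.lsmul R M (α • a + β • b)) = I • (⊤ : Submodule R M))
    (hnil : I ^ d • (⊤ : Submodule R M) = ⊥)
    (ha : (finrank k M : ℤ) - 2 * finrank k (↥(I • (⊤ : Submodule R M)))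
        + finrank k (↥(I ^ 2 • (⊤ : Submodule R M))) = 1)
    (n : ℕ) (hn : n = finrank k (M ⧸ (I • (⊤ : Submodule R M)))) :
    ∃ v : Fin n → M, (∀ i : Fin n, i.val = 0 → a • v i = 0) ∧
      (∀ i : Fin n, i.val = n - 1 → b • v i = 0) ∧
      (∀ i j : Fin n, j.val = i.val + 1 → b • v i = a • v j) ∧
      Submodule.span R (Set.range v) = ⊤ := by
  have hspan : ∀ α β : k, (α ≠ 0 ∨ β ≠ 0) → ∀ j : ℕ,
      (I ^ j • (⊤ : Submodule R M)).map (LinearMap.lsmul R M (α • a + β • b))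
        = I ^ (j + 1) • (⊤ : Submodule R M) := by
    intro α β hu j
    rw [Submodule.map_smul'', Submodule.map_top, hEIP α β hu, ← Submodule.smul_assoc, smul_eq_mul,
      pow_succ]
  let x : M →ₗ[k] M := (LinearMap.lsmul R M a).restrictScalars k
  let y : M →ₗ[k] M := (LinearMap.lsmul R M b).restrictScalars k
  let F : ℕ → Submodule k M := fun j =>
    (I ^ j • (⊤ : Submodule R M)).restrictScalars k
  have hF0 : F 0 = ⊤ := by
    simp only [F, pow_zero, one_smul, Ideal.one_eq_top, Submodule.top_smul]
    rfl
  have hFd : F d = ⊥ := by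
    simp only [F, hnil]
    rfl
  have anti : ∀ j, F (j + 1) ≤ F j := by
    intro j
    have h : I ^ (j + 1) • (⊤ : Submodule R M) ≤ I ^ j • (⊤ : Submodule R M) :=
      Submodule.smul_mono (Ideal.pow_le_pow_right (Nat.le_succ j)) le_rfl
    intro m hm
    exact h hm
  have hF : ∀ j, ∀ α β : k, (α ≠ 0 ∨ β ≠ 0) → (F j).map (α • x + β • y) = F (j + 1) := by
    intro j α β hab
    have h := hspan α β hab j
    have hu : ∀ m : M, (α • x + β • y) m = (α • a + β • b) • m := by
      intro m
      simp only [x, y, LinearMap.add_apply, LinearMap.smul_apply, LinearMap.restrictScalars_apply,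
        LinearMap.lsmul_apply, add_smul, smul_assoc]
    ext m
    have h2 : m ∈ F (j + 1) ↔ m ∈ I ^ (j + 1) • (⊤ : Submodule R M) := Iff.rfl
    rw [h2, ← h]
    constructor
    · rintro ⟨a, ha, rfl⟩
      exact ⟨a, ha, (hu a).symm⟩
    · rintro ⟨a, ha, rfl⟩
      exact ⟨a, ha, hu a⟩
  have hd1' : finrank k (F 1) = finrank k (↥(I • (⊤ : Submodule R M))) := by
    have : F 1 = (I • (⊤ : Submodule R M)).restrictScalars k := by
      simp only [F, pow_one]
    rw [this]
    rfl
  have hd2' : finrank k (F 2) = finrank k (↥(I ^ 2 • (⊤ : Submodule R M))) := rfl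
  have hq : finrank k (M ⧸ (I • (⊤ : Submodule R M))) = finrank k (M ⧸ F 1) := by
    have : F 1 = (I • (⊤ : Submodule R M)).restrictScalars k := by
      simp only [F, pow_one]
    rw [this]
    exact (Submodule.Quotient.restrictScalarsEquiv k
      (I • (⊤ : Submodule R M))).finrank_eq.symm
  have h0 : finrank k M = finrank k (F 1) + n := by
    have := Submodule.finrank_quotient_add_finrank (F 1)
    omega
  have h1 : finrank k (F 1) + 1 = finrank k (F 2) + n := by
    rw [← hd1', ← hd2'] at ha
    omega
  obtain ⟨v, r1, r2, r3, hgen⟩ := core x y F hF0 hF anti d hFd n h0 h1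
  refine ⟨v, r1, r2, r3, ?_⟩
  have hsup : Submodule.span R (Set.range v) ⊔ I • (⊤ : Submodule R M) = ⊤ := by
    rw [eq_top_iff]
    intro m _
    have hm : m ∈ Submodule.span k (Set.range v) ⊔ F 1 := hgen ▸ Submodule.mem_top
    obtain ⟨a', ha', b', hb, rfl⟩ := Submodule.mem_sup.mp hm
    refine Submodule.add_mem_sup ?_ ?_
    · have : Submodule.span k (Set.range v) ≤ (Submodule.span R (Set.range v)).restrictScalars k := by
        rw [Submodule.span_le]
        rintro _ ⟨i, rfl⟩
        exact Submodule.subset_span (Set.mem_range_self i)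
      exact this ha'
    · simpa only [F, pow_one, Submodule.restrictScalars_mem] using hb
  have hnak : ∀ j : ℕ, Submodule.span R (Set.range v) ⊔ I ^ j • (⊤ : Submodule R M) = ⊤ := by
    intro j
    induction j with
    | zero => simp
    | succ j ih =>
      rw [eq_top_iff]
      calc (⊤ : Submodule R M)
          = Submodule.span R (Set.range v) ⊔ I • (Submodule.span R (Set.range v) ⊔
              I ^ j • (⊤ : Submodule R M)) := by rw [ih, hsup]
        _ ≤ _ := by
          rw [Submodule.smul_sup, ← Submodule.smul_assoc, smul_eq_mul, ← pow_succ']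
          exact sup_le le_sup_left (sup_le (Submodule.smul_le_right.trans le_sup_left) le_sup_right)
  have := hnak d
  rwa [hnil, sup_bot_eq] at this

/-- if `M` lies in `EIP_d` with `a_1(M) = 1` and `n = dim_k M/𝔪M ≥ d`, then
there is a surjective `A`-linear map `W_{n,d} → M`. -/
theorem exists_surjection_from_W
    [IsAlgClosed k] [Fact p.Prime] [CharP k p]
    (d : ℕ) (hd1 : 1 ≤ d) (hdp : d ≤ p)
    (M : Type) [AddCommGroup M] [Module (Amod k p) M]
    [Module k M] [IsScalarTower k (Amod k p) M] [FiniteDimensional k M]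
    (hE : EIPd k p d M)
    (ha : (finrank k M : ℤ)
        - 2 * finrank k (↥(mA k p • (⊤ : Submodule (Amod k p) M)))
        + finrank k (↥((mA k p) ^ 2 • (⊤ : Submodule (Amod k p) M))) = 1)
    (n : ℕ) (hn : n = finrank k (M ⧸ (mA k p • (⊤ : Submodule (Amod k p) M))))
    (hnd : d ≤ n) :
    ∃ f : Wmod k p n d →ₗ[Amod k p] M, Function.Surjective f := by
  classical
  obtain ⟨hEIP, hnil⟩ := hE
  obtain ⟨v, r1, r2, r3, hgen⟩ := general_core (k := k) (R := Amod k p) (mA k p) (xA k p) (yA k p)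
    d M (fun α β h => hEIP _ ⟨α, β, h, rfl⟩) hnil ha n hn
  let L : (Fin n → Amod k p) →ₗ[Amod k p] M := Fintype.linearCombination (Amod k p) v
  have hL : ∀ i, L (stdV k p n i) = v i := by
    intro i
    simp [L, stdV, Fintype.linearCombination_apply_single]
  have hxm : xA k p ∈ mA k p := Ideal.subset_span (by simp)
  have hnil' : ∀ m : M, (xA k p) ^ d • m = 0 := by
    intro m
    have : (xA k p) ^ d • m ∈ (mA k p) ^ d • (⊤ : Submodule (Amod k p) M) :=
      Submodule.smul_mem_smul (Ideal.pow_mem_pow hxm d) Submodule.mem_top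
    rw [hnil] at this
    exact (Submodule.mem_bot _).mp this
  have hle : NSub k p n d ≤ LinearMap.ker L := by
    refine Submodule.span_le.mpr ?_
    intro s hs
    simp only [NSet, Set.mem_union, Set.mem_iUnion, Set.mem_singleton_iff] at hs
    change L s = 0
    rcases hs with ((⟨i, hi, rfl⟩ | ⟨i, hi, rfl⟩) | ⟨i, hi, rfl⟩) | ⟨i, j, hij, rfl⟩
    · rw [map_smul, hL]
      exact r1 i hi
    · rw [map_smul, hL]
      exact r2 i hi
    · rw [map_smul, hL]
      exact hnil' (v i)
    · rw [map_sub, map_smul, map_smul, hL, hL]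
      exact sub_eq_zero.mpr (r3 i j hij)
  refine ⟨(NSub k p n d).liftQ L hle, ?_⟩
  rw [← LinearMap.range_eq_top, Submodule.range_liftQ, eq_top_iff, ← hgen, Submodule.span_le]
  rintro _ ⟨i, rfl⟩
  exact ⟨_, hL i⟩

end
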